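/- arXiv:1105.0097 — 2 statements merged into one kernel-verified Lean document; each statement's English description precedes it below -/
import Mathlib

section
/- If the spectrum of a unitary operator S on a Hilbert space equals the arc {e^{iϑ} : ϑ ∈ [−λ₀, λ₀]} with 0 ≤ λ₀ ≤ π/d, then the spectrum of the d-fold tensor product S_d = S ⊗ ⋯ ⊗ S equals {e^{iϑ} : ϑ ∈ [−d λ₀, d λ₀]}. -/
open scoped InnerProductSpace
open Complex


theorem spectrum_mul_of_commute {B : Type*} [NormedRing B] [NormedAlgebra ℂ B] [CompleteSpace B]
    (a b : B) (hab : Commute a b) {z : ℂ} (hz : z ∈ spectrum ℂ (a * b)) :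
    ∃ u ∈ spectrum ℂ a, ∃ v ∈ spectrum ℂ b, z = u * v := by
  classical
  set A : Subalgebra ℂ B := Subalgebra.centralizer ℂ (Set.centralizer {a, b}) with hA
  have hcomm : ∀ x ∈ ({a, b} : Set B), ∀ y ∈ ({a, b} : Set B), x * y = y * x := by
    have := hab.eq
    rintro x (rfl | rfl) y (rfl | rfl) <;> simp [this]
  have hAc : ∀ x y : A, x * y = y * x := by
    intro x y
    apply Subtype.ext
    exact Set.centralizer_centralizer_comm_of_comm hcomm _ x.2 _ y.2
  have hclosed : IsClosed (A : Set B) := by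
    rw [hA, Subalgebra.coe_centralizer]
    exact Set.isClosed_centralizer _
  have : CompleteSpace A := hclosed.completeSpace_coe
  let : NormedCommRing A := { (inferInstance : NormedRing A) with mul_comm := hAc }
  have hmem : ∀ x ∈ ({a, b} : Set B), x ∈ A := fun x hx => Set.subset_centralizer_centralizer hx
  let a' : A := ⟨a, hmem a (by simp)⟩
  let b' : A := ⟨b, hmem b (by simp)⟩
  have hunit : ∀ x : A, IsUnit (x : B) → IsUnit x := by
    intro x hx
    obtain ⟨u, hu⟩ := hx
    have hi : (↑u⁻¹ : B) ∈ A := by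
      rw [hA, Subalgebra.mem_centralizer_iff]
      intro g hg
      have h1 : Commute g (x : B) := (Subalgebra.mem_centralizer_iff ℂ).1 x.2 g hg
      rw [← hu] at h1
      exact h1.units_inv_right.eq
    exact IsUnit.of_mul_eq_one ⟨_, hi⟩ (Subtype.ext (by simp [← hu]))
  have hsub : ∀ x : A, spectrum ℂ x = spectrum ℂ (x : B) := by
    intro x
    apply Set.Subset.antisymm
    · intro w hw
      rw [spectrum.mem_iff] at hw ⊢
      intro h
      exact hw (hunit (algebraMap ℂ A w - x) (by simpa using h))
    · exact spectrum.subset_subalgebra x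
  have hz' : z ∈ spectrum ℂ (a' * b') := by rw [hsub]; exact hz
  have : Nontrivial A := by
    by_contra h
    rw [not_nontrivial_iff_subsingleton] at h
    exact hz' (isUnit_of_subsingleton _)
  obtain ⟨φ, hφ⟩ := WeakDual.CharacterSpace.mem_spectrum_iff_exists.1 hz'
  refine ⟨φ a', ?_, φ b', ?_, ?_⟩
  · have := AlgHom.apply_mem_spectrum φ a'
    rwa [hsub] at this
  · have := AlgHom.apply_mem_spectrum φ b'
    rwa [hsub] at this
  · rw [← hφ, map_mul]

theorem exists_approx_eigenvector {H : Type*} [NormedAddCommGroup H] [InnerProductSpace ℂ H]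
    [CompleteSpace H] (S : H →L[ℂ] H) (hS : IsStarNormal S) {z : ℂ} (hz : z ∈ spectrum ℂ S)
    {ε : ℝ} (hε : 0 < ε) : ∃ x : H, ‖x‖ = 1 ∧ ‖(S - algebraMap ℂ _ z) x‖ ≤ ε := by
  by_contra! hcon
  set T : H →L[ℂ] H := S - algebraMap ℂ _ z with hT
  have hTn : IsStarNormal T := by
    rw [hT]
    refine ⟨?_⟩
    have h0 := hS.star_comm_self
    simp only [star_sub, ← algebraMap_star_comm]
    exact ((h0.sub_left (Algebra.commutes _ _)).sub_right
      (Algebra.commutes _ _).symm)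
  have hb : ∀ x, ε * ‖x‖ ≤ ‖T x‖ := by
    intro x
    by_cases hx : x = 0
    · simp [hx]
    have hx' : 0 < ‖x‖ := norm_pos_iff.2 hx
    have := hcon ((‖x‖⁻¹ : ℂ) • x) (by rw [norm_smul]; simp [hx'.ne'])
    rw [map_smul, norm_smul] at this
    simp only [norm_inv, norm_real, norm_norm] at this
    rw [inv_mul_eq_div, lt_div_iff₀ hx'] at this
    exact this.le
  have hanti : AntilipschitzWith (ε.toNNReal)⁻¹ T := by
    apply ContinuousLinearMap.antilipschitz_of_bound
    intro x
    have := hb x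
    rw [NNReal.coe_inv, Real.coe_toNNReal _ hε.le, inv_mul_eq_div, le_div_iff₀ hε]
    linarith
  have hclosed : IsClosed (T.range : Set H) := by
    rw [LinearMap.coe_range]
    exact hanti.isClosed_range T.uniformContinuous
  have hker : T.ker = ⊥ := LinearMap.ker_eq_bot.2 hanti.injective
  have hr : T.range = ⊤ := by
    have : CompleteSpace T.range := hclosed.completeSpace_coe
    rw [← Submodule.orthogonal_eq_bot_iff, ContinuousLinearMap.IsStarNormal.orthogonal_range hTn, hker]
  have hu : IsUnit T := by
    rw [ContinuousLinearMap.isUnit_iff_bijective]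
    exact ⟨hanti.injective, LinearMap.range_eq_top.1 hr⟩
  rw [spectrum.mem_iff] at hz
  apply hz
  have := hu.neg
  rwa [hT, neg_sub] at this

theorem l2_hasSum {α : Type*} (f : lp (fun _ : α => ℂ) 2) :
    HasSum (fun k => ‖f k‖ ^ 2) (‖f‖ ^ 2) := by
  have := lp.hasSum_norm (p := 2) (by norm_num) f
  simpa using this

theorem l2_mem {α : Type*} {f : α → ℂ} (h : Summable fun k => ‖f k‖ ^ 2) : Memℓp f 2 := by
  apply memℓp_gen
  simpa using h

/-- The slice of `f` through `k` in direction `j`. -/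
noncomputable def slice {d : ℕ} (j : Fin d) (k : Fin d → ℤ)
    (f : lp (fun _ : Fin d → ℤ => ℂ) 2) : lp (fun _ : ℤ => ℂ) 2 :=
  ⟨fun n => f (Function.update k j n), l2_mem <|
    (l2_hasSum f).summable.comp_injective (Function.update_injective k j)⟩

theorem slice_apply {d : ℕ} (j : Fin d) (k : Fin d → ℤ)
    (f : lp (fun _ : Fin d → ℤ => ℂ) 2) (n : ℤ) : slice j k f n = f (Function.update k j n) := rfl

theorem slice_update {d : ℕ} (j : Fin d) (k : Fin d → ℤ)
    (f : lp (fun _ : Fin d → ℤ => ℂ) 2) (n : ℤ) :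
    slice j (Function.update k j n) f = slice j k f := by
  apply lp.ext; funext m; simp [slice_apply]

theorem slice_add {d : ℕ} (j : Fin d) (k : Fin d → ℤ)
    (f g : lp (fun _ : Fin d → ℤ => ℂ) 2) :
    slice j k (f + g) = slice j k f + slice j k g := by
  apply lp.ext; funext m; simp [slice_apply]

theorem slice_smul {d : ℕ} (j : Fin d) (k : Fin d → ℤ) (c : ℂ)
    (f : lp (fun _ : Fin d → ℤ => ℂ) 2) :
    slice j k (c • f) = c • slice j k f := by
  apply lp.ext; funext m; simp [slice_apply]

/-- Splitting off the coordinate `j`. -/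
noncomputable def splitE {d : ℕ} (j : Fin d) : ({i : Fin d // i ≠ j} → ℤ) × ℤ ≃ (Fin d → ℤ) :=
  (Equiv.prodComm _ _).trans (Equiv.funSplitAt j ℤ).symm

theorem splitE_eq {d : ℕ} (j : Fin d) (m : {i : Fin d // i ≠ j} → ℤ) (n : ℤ) :
    splitE j (m, n) = Function.update (splitE j (m, 0)) j n := by
  funext i
  by_cases h : i = j
  · subst h; simp [splitE]
  · simp [splitE, h]

theorem splitE_self {d : ℕ} (j : Fin d) (m : {i : Fin d // i ≠ j} → ℤ) (n : ℤ) :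
    splitE j (m, n) j = n := by
  rw [splitE_eq]; simp

theorem slice_hasSum {d : ℕ} (j : Fin d) (f : lp (fun _ : Fin d → ℤ => ℂ) 2) :
    HasSum (fun m => ‖slice j (splitE j (m, 0)) f‖ ^ 2) (‖f‖ ^ 2) := by
  have h := (splitE j).hasSum_iff.2 (l2_hasSum f)
  refine h.prod_fiberwise fun m => ?_
  have := l2_hasSum (slice j (splitE j (m, 0)) f)
  simpa only [slice_apply, ← splitE_eq, Function.comp] using this

theorem amp_mem {d : ℕ} (j : Fin d) (T : lp (fun _ : ℤ => ℂ) 2 →L[ℂ] lp (fun _ : ℤ => ℂ) 2)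
    (f : lp (fun _ : Fin d → ℤ => ℂ) 2) :
    Memℓp (fun k : Fin d → ℤ => (T (slice j k f) (k j) : ℂ)) 2 := by
  apply l2_mem
  rw [← (splitE j).summable_iff]
  refine (summable_prod_of_nonneg (fun p => sq_nonneg ‖T (slice j (splitE j p) f) (splitE j p j)‖)).2 ?_
  have key : ∀ m n, ‖T (slice j (splitE j (m, n)) f) (splitE j (m, n) j)‖ ^ 2
      = ‖T (slice j (splitE j (m, 0)) f) n‖ ^ 2 := by
    intro m n
    rw [splitE_self, splitE_eq, slice_update]
  simp only [Function.comp, key]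
  refine ⟨fun m => (l2_hasSum _).summable, ?_⟩
  simp only [(l2_hasSum _).tsum_eq]
  refine Summable.of_nonneg_of_le (fun _ => by positivity) (fun m => ?_)
    ((slice_hasSum j f).summable.mul_left (‖T‖ ^ 2))
  rw [← mul_pow]
  gcongr
  exact T.le_opNorm _

/-- The vector `(1 ⊗ ⋯ ⊗ T ⊗ ⋯ ⊗ 1) f`. -/
noncomputable def ampFun {d : ℕ} (j : Fin d)
    (T : lp (fun _ : ℤ => ℂ) 2 →L[ℂ] lp (fun _ : ℤ => ℂ) 2)
    (f : lp (fun _ : Fin d → ℤ => ℂ) 2) : lp (fun _ : Fin d → ℤ => ℂ) 2 :=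
  ⟨fun k => T (slice j k f) (k j), amp_mem j T f⟩

theorem ampFun_apply {d : ℕ} (j : Fin d)
    (T : lp (fun _ : ℤ => ℂ) 2 →L[ℂ] lp (fun _ : ℤ => ℂ) 2)
    (f : lp (fun _ : Fin d → ℤ => ℂ) 2) (k : Fin d → ℤ) :
    ampFun j T f k = T (slice j k f) (k j) := rfl

theorem slice_ampFun {d : ℕ} (j : Fin d)
    (T : lp (fun _ : ℤ => ℂ) 2 →L[ℂ] lp (fun _ : ℤ => ℂ) 2)
    (f : lp (fun _ : Fin d → ℤ => ℂ) 2) (k : Fin d → ℤ) :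
    slice j k (ampFun j T f) = T (slice j k f) := by
  apply lp.ext; funext n
  simp [slice_apply, ampFun_apply, slice_update]

theorem norm_ampFun_le {d : ℕ} (j : Fin d)
    (T : lp (fun _ : ℤ => ℂ) 2 →L[ℂ] lp (fun _ : ℤ => ℂ) 2)
    (f : lp (fun _ : Fin d → ℤ => ℂ) 2) : ‖ampFun j T f‖ ≤ ‖T‖ * ‖f‖ := by
  apply le_of_sq_le_sq _ (by positivity)
  rw [mul_pow]
  refine hasSum_le (fun m => ?_) (slice_hasSum j (ampFun j T f))
    ((slice_hasSum j f).mul_left (‖T‖ ^ 2))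
  rw [slice_ampFun, ← mul_pow]
  gcongr
  exact T.le_opNorm _

/-- The operator `1 ⊗ ⋯ ⊗ T ⊗ ⋯ ⊗ 1`. -/
noncomputable def ampCLM {d : ℕ} (j : Fin d)
    (T : lp (fun _ : ℤ => ℂ) 2 →L[ℂ] lp (fun _ : ℤ => ℂ) 2) :
    lp (fun _ : Fin d → ℤ => ℂ) 2 →L[ℂ] lp (fun _ : Fin d → ℤ => ℂ) 2 :=
  LinearMap.mkContinuous
    { toFun := ampFun j T
      map_add' := fun f g => by
        apply lp.ext; funext k; simp [ampFun_apply, slice_add]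
      map_smul' := fun c f => by
        apply lp.ext; funext k; simp [ampFun_apply, slice_smul] } ‖T‖ (norm_ampFun_le j T)

theorem ampCLM_apply {d : ℕ} (j : Fin d)
    (T : lp (fun _ : ℤ => ℂ) 2 →L[ℂ] lp (fun _ : ℤ => ℂ) 2)
    (f : lp (fun _ : Fin d → ℤ => ℂ) 2) (k : Fin d → ℤ) :
    ampCLM j T f k = T (slice j k f) (k j) := rfl

theorem slice_ampCLM {d : ℕ} (j : Fin d)
    (T : lp (fun _ : ℤ => ℂ) 2 →L[ℂ] lp (fun _ : ℤ => ℂ) 2)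
    (f : lp (fun _ : Fin d → ℤ => ℂ) 2) (k : Fin d → ℤ) :
    slice j k (ampCLM j T f) = T (slice j k f) := slice_ampFun j T f k

/-- `T ↦ 1 ⊗ ⋯ ⊗ T ⊗ ⋯ ⊗ 1` as an algebra homomorphism. -/
noncomputable def amp {d : ℕ} (j : Fin d) :
    (lp (fun _ : ℤ => ℂ) 2 →L[ℂ] lp (fun _ : ℤ => ℂ) 2) →ₐ[ℂ]
    (lp (fun _ : Fin d → ℤ => ℂ) 2 →L[ℂ] lp (fun _ : Fin d → ℤ => ℂ) 2) where
  toFun := ampCLM j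
  map_one' := by
    ext f k; simp [ampCLM_apply, slice_apply]
  map_mul' := fun T U => by
    ext1 f; apply lp.ext; funext k
    simp [ampCLM_apply, slice_ampCLM]
  map_zero' := by
    ext1 f; apply lp.ext; funext k; simp [ampCLM_apply]
  map_add' := fun T U => by
    ext1 f; apply lp.ext; funext k; simp [ampCLM_apply]
  commutes' := fun c => by
    ext1 f; apply lp.ext; funext k
    simp [ampCLM_apply, Algebra.algebraMap_eq_smul_one, slice_apply]

theorem amp_apply {d : ℕ} (j : Fin d)
    (T : lp (fun _ : ℤ => ℂ) 2 →L[ℂ] lp (fun _ : ℤ => ℂ) 2)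
    (f : lp (fun _ : Fin d → ℤ => ℂ) 2) (k : Fin d → ℤ) :
    amp j T f k = T (slice j k f) (k j) := rfl

theorem norm_amp_apply_le {d : ℕ} (j : Fin d)
    (T : lp (fun _ : ℤ => ℂ) 2 →L[ℂ] lp (fun _ : ℤ => ℂ) 2)
    (f : lp (fun _ : Fin d → ℤ => ℂ) 2) : ‖amp j T f‖ ≤ ‖T‖ * ‖f‖ := norm_ampFun_le j T f

/-! Product vectors. -/

theorem pure_sum_le {d : ℕ} (x : Fin d → lp (fun _ : ℤ => ℂ) 2) (s : Finset (Fin d → ℤ)) :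
    ∑ k ∈ s, ‖∏ i, x i (k i)‖ ^ 2 ≤ ∏ i, ‖x i‖ ^ 2 := by
  classical
  calc ∑ k ∈ s, ‖∏ i, x i (k i)‖ ^ 2
      ≤ ∑ k ∈ Fintype.piFinset (fun i => s.image (fun k => k i)), ‖∏ i, x i (k i)‖ ^ 2 := by
        apply Finset.sum_le_sum_of_subset_of_nonneg
        · intro k hk
          rw [Fintype.mem_piFinset]
          exact fun i => Finset.mem_image_of_mem _ hk
        · intros; positivity
    _ = ∏ i, ∑ n ∈ s.image (fun k => k i), ‖x i n‖ ^ 2 := by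
        rw [Finset.prod_univ_sum]
        simp [norm_prod, Finset.prod_pow]
    _ ≤ ∏ i, ‖x i‖ ^ 2 := by
        refine Finset.prod_le_prod (fun i _ => Finset.sum_nonneg fun _ _ => by positivity)
          fun i _ => ?_
        exact sum_le_hasSum _ (fun _ _ => by positivity) (l2_hasSum (x i))

/-- The product vector `x₁ ⊗ ⋯ ⊗ x_d`. -/
noncomputable def pureVec {d : ℕ} (x : Fin d → lp (fun _ : ℤ => ℂ) 2) :
    lp (fun _ : Fin d → ℤ => ℂ) 2 :=
  ⟨fun k => ∏ i, x i (k i), l2_mem <|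
    summable_of_sum_le (fun _ => by positivity) (pure_sum_le x)⟩

theorem pureVec_apply {d : ℕ} (x : Fin d → lp (fun _ : ℤ => ℂ) 2) (k : Fin d → ℤ) :
    pureVec x k = ∏ i, x i (k i) := rfl

theorem norm_pureVec {d : ℕ} (x : Fin d → lp (fun _ : ℤ => ℂ) 2) :
    ‖pureVec x‖ = ∏ i, ‖x i‖ := by
  classical
  have h2 : ‖pureVec x‖ ^ 2 = (∏ i, ‖x i‖) ^ 2 := by
    rw [← Finset.prod_pow]
    apply le_antisymm
    · exact hasSum_le_of_sum_le (l2_hasSum (pureVec x)) (pure_sum_le x)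
    · have ht : Filter.Tendsto (fun s : Finset ℤ => ∏ i, ∑ n ∈ s, ‖x i n‖ ^ 2) Filter.atTop
          (nhds (∏ i, ‖x i‖ ^ 2)) := tendsto_finsetProd _ fun i _ => l2_hasSum (x i)
      refine le_of_tendsto' ht fun s => ?_
      have := sum_le_hasSum (Fintype.piFinset (fun _ : Fin d => s)) (fun _ _ => by positivity)
        (l2_hasSum (pureVec x))
      refine le_trans (le_of_eq ?_) this
      rw [Finset.prod_univ_sum]
      simp [norm_prod, Finset.prod_pow, pureVec_apply]
  exact (pow_left_inj₀ (norm_nonneg _) (by positivity) two_ne_zero).1 h2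

theorem amp_pureVec {d : ℕ} (j : Fin d)
    (T : lp (fun _ : ℤ => ℂ) 2 →L[ℂ] lp (fun _ : ℤ => ℂ) 2)
    (x : Fin d → lp (fun _ : ℤ => ℂ) 2) :
    amp j T (pureVec x) = pureVec (Function.update x j (T (x j))) := by
  apply lp.ext; funext k
  have hs : slice j k (pureVec x) = (∏ i ∈ Finset.univ.erase j, x i (k i)) • x j := by
    apply lp.ext; funext n
    rw [slice_apply, pureVec_apply, ← Finset.mul_prod_erase _ _ (Finset.mem_univ j)]
    simp only [Function.update_self, lp.coeFn_smul, Pi.smul_apply, smul_eq_mul]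
    rw [mul_comm]
    congr 1
    refine Finset.prod_congr rfl fun i hi => ?_
    rw [Function.update_of_ne (Finset.ne_of_mem_erase hi)]
  rw [amp_apply, hs, map_smul, pureVec_apply, ← Finset.mul_prod_erase _ _ (Finset.mem_univ j)]
  simp only [Function.update_self, lp.coeFn_smul, Pi.smul_apply, smul_eq_mul]
  rw [mul_comm]
  congr 1
  refine Finset.prod_congr rfl fun i hi => ?_
  rw [Function.update_of_ne (Finset.ne_of_mem_erase hi)]

theorem pureVec_single {d : ℕ} (l : Fin d → ℤ) :
    pureVec (fun i => lp.single 2 (l i) (1 : ℂ)) = lp.single 2 l (1 : ℂ) := by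
  apply lp.ext; funext k
  rw [pureVec_apply, lp.single_apply]
  by_cases h : k = l
  · subst h; simp
  · obtain ⟨i, hi⟩ := Function.ne_iff.1 h
    rw [Finset.prod_eq_zero (Finset.mem_univ i)]
    · simp [h]
    · rw [lp.single_apply]; simp [hi]

theorem ext_pureVec {d : ℕ}
    {A B : lp (fun _ : Fin d → ℤ => ℂ) 2 →L[ℂ] lp (fun _ : Fin d → ℤ => ℂ) 2}
    (h : ∀ l : Fin d → ℤ, A (pureVec (fun i => lp.single 2 (l i) (1 : ℂ))) =
      B (pureVec (fun i => lp.single 2 (l i) (1 : ℂ)))) : A = B := by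
  apply lp.ext_continuousLinearMap (by norm_num)
  intro l
  ext1
  simpa [pureVec_single] using h l

theorem amp_commute {d : ℕ} (i j : Fin d)
    (T : lp (fun _ : ℤ => ℂ) 2 →L[ℂ] lp (fun _ : ℤ => ℂ) 2) :
    Commute (amp i T) (amp j T) := by
  by_cases hij : i = j
  · subst hij; exact Commute.refl _
  · apply ext_pureVec
    intro l
    simp only [mul_apply_eq_comp, amp_pureVec]
    rw [Function.update_of_ne hij, Function.update_of_ne (Ne.symm hij), Function.update_comm hij]

theorem list_amp_pureVec {d : ℕ}
    (T : lp (fun _ : ℤ => ℂ) 2 →L[ℂ] lp (fun _ : ℤ => ℂ) 2)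
    (x : Fin d → lp (fun _ : ℤ => ℂ) 2) (L : List (Fin d)) (hL : L.Nodup) :
    (L.map fun j => amp j T).prod (pureVec x) =
      pureVec (fun i => if i ∈ L then T (x i) else x i) := by
  induction L with
  | nil => simp
  | cons a L ih =>
    rw [List.nodup_cons] at hL
    rw [List.map_cons, List.prod_cons, mul_apply_eq_comp, ih hL.2, amp_pureVec]
    congr 1
    funext i
    by_cases h : i = a
    · subst h; simp [hL.1]
    · simp [h]

theorem list_amp_approx {d : ℕ}
    (T : lp (fun _ : ℤ => ℂ) 2 →L[ℂ] lp (fun _ : ℤ => ℂ) 2) (hT : ‖T‖ ≤ 1) (z : ℂ) (hz : ‖z‖ = 1)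
    (f : lp (fun _ : Fin d → ℤ => ℂ) 2) (ε : ℝ) (hf : ∀ j, ‖amp j T f - z • f‖ ≤ ε)
    (L : List (Fin d)) :
    ‖(L.map fun j => amp j T).prod f - z ^ L.length • f‖ ≤ L.length * ε := by
  induction L with
  | nil => simp
  | cons a L ih =>
    rw [List.map_cons, List.prod_cons, ContinuousLinearMap.mul_apply]
    set P := (L.map fun j => amp j T).prod f
    have e : amp a T P - z ^ (a :: L).length • f =
        amp a T (P - z ^ L.length • f) + z ^ L.length • (amp a T f - z • f) := by
      rw [map_sub, map_smul, smul_sub, smul_smul, List.length_cons, pow_succ]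
      abel
    rw [e]
    refine (norm_add_le _ _).trans ?_
    have h1 : ‖amp a T (P - z ^ L.length • f)‖ ≤ L.length * ε :=
      (norm_amp_apply_le a T _).trans ((mul_le_of_le_one_left (norm_nonneg _) hT).trans ih)
    have h2 : ‖z ^ L.length • (amp a T f - z • f)‖ ≤ ε := by
      rw [norm_smul, norm_pow, hz, one_pow, one_mul]; exact hf a
    rw [List.length_cons]; push_cast
    linarith

theorem list_amp_spectrum {d : ℕ} (lam0 : ℝ)
    (T : lp (fun _ : ℤ => ℂ) 2 →L[ℂ] lp (fun _ : ℤ => ℂ) 2)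
    (hspec : spectrum ℂ T ⊆ {z : ℂ | ∃ ϑ : ℝ, |ϑ| ≤ lam0 ∧ z = Complex.exp (ϑ * Complex.I)})
    (L : List (Fin d)) :
    spectrum ℂ (L.map fun j => amp j T).prod ⊆
      {z : ℂ | ∃ ϑ : ℝ, |ϑ| ≤ L.length * lam0 ∧ z = Complex.exp (ϑ * Complex.I)} := by
  induction L with
  | nil =>
    intro z hz
    have hne : Nontrivial (lp (fun _ : Fin d → ℤ => ℂ) 2 →L[ℂ] lp (fun _ : Fin d → ℤ => ℂ) 2) := by
      by_contra h
      rw [not_nontrivial_iff_subsingleton] at h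
      exact hz (isUnit_of_subsingleton _)
    rw [List.map_nil, List.prod_nil, spectrum.one_eq, Set.mem_singleton_iff] at hz
    exact ⟨0, by simp, by simp [hz]⟩
  | cons a L ih =>
    intro z hz
    rw [List.map_cons, List.prod_cons] at hz
    have hc : Commute (amp a T) (L.map fun j => amp j T).prod := by
      apply Commute.list_prod_right
      intro y hy
      obtain ⟨j, -, rfl⟩ := List.mem_map.1 hy
      exact amp_commute a j T
    obtain ⟨u, hu, v, hv, rfl⟩ := spectrum_mul_of_commute _ _ hc hz
    obtain ⟨s, hs, rfl⟩ := hspec (AlgHom.spectrum_apply_subset (amp a) T hu)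
    obtain ⟨t, ht, rfl⟩ := ih hv
    refine ⟨s + t, ?_, ?_⟩
    · rw [List.length_cons]; push_cast
      have := abs_add_le s t
      linarith
    · rw [← Complex.exp_add]; push_cast; ring_nf

local notation "ℓ²ℤ" => lp (fun _ : ℤ => ℂ) 2

/-- If the spectrum of a unitary `S` is the arc `{e^{iϑ} : |ϑ| ≤ λ₀}` with
`0 ≤ λ₀ ≤ π/d`, then the spectrum of the `d`-fold tensor power `S_d` (realized on
`ℓ²(ℤ^d)` via product matrix elements in the canonical basis) is the arc
`{e^{iϑ} : |ϑ| ≤ d·λ₀}`. -/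
theorem stmt8 (d : ℕ) (hd : 0 < d) (lam0 : ℝ) (hlam0 : 0 ≤ lam0)
    (hlam0' : lam0 ≤ Real.pi / d)
    (S : ℓ²ℤ →L[ℂ] ℓ²ℤ) (hS : S ∈ unitary (ℓ²ℤ →L[ℂ] ℓ²ℤ))
    (hspec : spectrum ℂ S = {z : ℂ | ∃ ϑ : ℝ, |ϑ| ≤ lam0 ∧ z = Complex.exp (ϑ * Complex.I)})
    (Sd : lp (fun _ : Fin d → ℤ => ℂ) 2 →L[ℂ] lp (fun _ : Fin d → ℤ => ℂ) 2)
    (hSd : ∀ k l : Fin d → ℤ,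
      ⟪lp.single 2 k (1 : ℂ), Sd (lp.single 2 l (1 : ℂ))⟫_ℂ =
        ∏ j : Fin d, ⟪lp.single 2 (k j) (1 : ℂ), S (lp.single 2 (l j) (1 : ℂ))⟫_ℂ) :
    spectrum ℂ Sd =
      {z : ℂ | ∃ ϑ : ℝ, |ϑ| ≤ d * lam0 ∧ z = Complex.exp (ϑ * Complex.I)} := by
  have hprod : Sd = ((List.finRange d).map fun j => amp j S).prod := by
    apply ext_pureVec
    intro l
    rw [list_amp_pureVec _ _ _ (List.nodup_finRange d), pureVec_single]
    apply lp.ext; funext k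
    have := hSd k l
    simp only [lp.inner_single_left] at this
    simpa [pureVec_apply] using this
  have hlen : (List.finRange d).length = d := List.length_finRange
  apply Set.Subset.antisymm
  · have := list_amp_spectrum lam0 S hspec.subset (List.finRange d)
    rwa [← hprod, hlen] at this
  · rintro z ⟨t, ht, rfl⟩
    have hd' : (0 : ℝ) < d := by exact_mod_cast hd
    set w : ℂ := Complex.exp ((t / d : ℝ) * Complex.I) with hw
    have hwz : w ^ d = Complex.exp (t * Complex.I) := by
      rw [hw, ← Complex.exp_nat_mul]
      congr 1
      have : (d : ℂ) ≠ 0 := by exact_mod_cast hd.ne'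
      push_cast
      field_simp
    have hw1 : ‖w‖ = 1 := Complex.norm_exp_ofReal_mul_I _
    have hwS : w ∈ spectrum ℂ S := by
      rw [hspec]
      refine ⟨t / d, ?_, rfl⟩
      rw [abs_div, abs_of_pos hd', div_le_iff₀ hd']
      linarith
    have hSn : IsStarNormal S :=
      ⟨(Unitary.star_mul_self_of_mem hS).trans (Unitary.mul_star_self_of_mem hS).symm⟩
    have hnt : Nontrivial (ℓ²ℤ →L[ℂ] ℓ²ℤ) := by
      by_contra h
      rw [not_nontrivial_iff_subsingleton] at h
      exact hwS (isUnit_of_subsingleton _)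
    have hS1 : ‖S‖ ≤ 1 := (CStarRing.norm_of_mem_unitary hS).le
    rw [← hwz, spectrum.mem_iff]
    rintro ⟨u, hu⟩
    set C : ℝ := ‖(↑u⁻¹ : lp (fun _ : Fin d → ℤ => ℂ) 2 →L[ℂ] lp (fun _ : Fin d → ℤ => ℂ) 2)‖
    have hC : 0 ≤ C := norm_nonneg _
    set ε : ℝ := (2 * (C + 1) * d)⁻¹ with hε
    have hε0 : 0 < ε := by positivity
    obtain ⟨x, hx, hxε⟩ := exists_approx_eigenvector S hSn hwS hε0
    set f := pureVec (fun _ : Fin d => x) with hf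
    have hf1 : ‖f‖ = 1 := by rw [hf, norm_pureVec]; simp [hx]
    have hj : ∀ j, ‖amp j S f - w • f‖ ≤ ε := by
      intro j
      have e : amp j S f - w • f = amp j (S - algebraMap ℂ _ w) f := by
        rw [map_sub, AlgHom.commutes, sub_apply,
          Algebra.algebraMap_eq_smul_one]
        simp
      rw [e, hf, amp_pureVec, norm_pureVec, ← Finset.mul_prod_erase _ _ (Finset.mem_univ j)]
      rw [Finset.prod_eq_one, mul_one, Function.update_self]
      · exact hxε
      · intro i hi
        rw [Function.update_of_ne (Finset.ne_of_mem_erase hi), hx]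
    have hmain := list_amp_approx S hS1 w hw1 f ε hj (List.finRange d)
    rw [← hprod, hlen] at hmain
    have huf : (u : lp (fun _ : Fin d → ℤ => ℂ) 2 →L[ℂ] lp (fun _ : Fin d → ℤ => ℂ) 2) f
        = -(Sd f - w ^ d • f) := by
      rw [hu, Algebra.algebraMap_eq_smul_one]; simp
    have h1 : f = (↑u⁻¹ : lp (fun _ : Fin d → ℤ => ℂ) 2 →L[ℂ] lp (fun _ : Fin d → ℤ => ℂ) 2)
        ((u : lp (fun _ : Fin d → ℤ => ℂ) 2 →L[ℂ] lp (fun _ : Fin d → ℤ => ℂ) 2) f) := by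
      rw [← mul_apply_eq_comp, Units.inv_mul, one_apply_eq_self]
    have h2 : (1 : ℝ) ≤ C * (d * ε) := by
      calc (1 : ℝ) = ‖f‖ := hf1.symm
        _ ≤ C * ‖(u : lp (fun _ : Fin d → ℤ => ℂ) 2 →L[ℂ] lp (fun _ : Fin d → ℤ => ℂ) 2) f‖ := by
            conv_lhs => rw [h1]
            exact ContinuousLinearMap.le_opNorm _ _
        _ ≤ C * (d * ε) := by
            rw [huf, norm_neg]; gcongr
    have h3 : C * (d * ε) = C / (2 * (C + 1)) := by
      rw [hε]; field_simp
    rw [h3, le_div_iff₀ (by positivity)] at h2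
    linarith
end

section
/- Let S(t) on ℓ²(ℤ) be defined via 2×2 blocks as in the one-dimensional unitary Anderson model with parameters r, t ≥ 0, r² + t² = 1. Then the spectrum of S(t), computed by Fourier transform, equals the arc {e^{iϑ} : ϑ ∈ [−λ₀, λ₀]} where λ₀ = arccos(1 − 2t²). -/
open Complex ContinuousLinearMap

local notation "ℓ²ℤ" => lp (fun _ : ℤ => ℂ) 2

namespace UAM

/-- Reindexing of a square-summable sequence. -/
noncomputable def reFun (e : ℤ ≃ ℤ) (f : ℓ²ℤ) : ℓ²ℤ :=
  ⟨fun n => f (e n), by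
    apply memℓp_gen
    have h := (lp.memℓp f).summable (by norm_num)
    exact (e.summable_iff (f := fun i => ‖f i‖ ^ (2 : ENNReal).toReal)).2 h⟩

lemma reFun_apply (e : ℤ ≃ ℤ) (f : ℓ²ℤ) (n : ℤ) : reFun e f n = f (e n) := rfl

/-- Reindexing as a linear isometric equivalence. -/
noncomputable def re (e : ℤ ≃ ℤ) : ℓ²ℤ ≃ₗᵢ[ℂ] ℓ²ℤ where
  toFun := reFun e
  invFun := reFun e.symm
  map_add' f g := by ext n; simp [reFun_apply]
  map_smul' c f := by ext n; simp [reFun_apply]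
  left_inv f := by ext n; simp [reFun_apply]
  right_inv f := by ext n; simp [reFun_apply]
  norm_map' f := by
    have h2 : 0 < (2 : ENNReal).toReal := by norm_num
    change ‖reFun e f‖ = ‖f‖
    rw [lp.norm_eq_tsum_rpow h2, lp.norm_eq_tsum_rpow h2]
    congr 1
    exact e.tsum_eq (fun i => ‖f i‖ ^ (2 : ENNReal).toReal)

lemma re_apply (e : ℤ ≃ ℤ) (f : ℓ²ℤ) (n : ℤ) : re e f n = f (e n) := rfl
lemma re_symm_apply (e : ℤ ≃ ℤ) (f : ℓ²ℤ) (n : ℤ) : (re e).symm f n = f (e.symm n) := rfl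

lemma re_single (e : ℤ ≃ ℤ) (n : ℤ) :
    re e (lp.single 2 n (1 : ℂ)) = lp.single 2 (e.symm n) (1 : ℂ) := by
  ext m
  rw [re_apply, lp.single_apply, lp.single_apply, Pi.single_apply, Pi.single_apply]
  simp [Equiv.eq_symm_apply]

lemma re_symm_single (e : ℤ ≃ ℤ) (n : ℤ) :
    (re e).symm (lp.single 2 n (1 : ℂ)) = lp.single 2 (e n) (1 : ℂ) := by
  rw [LinearIsometryEquiv.symm_apply_eq, re_single]; simp

lemma ext_single {A B : ℓ²ℤ →L[ℂ] ℓ²ℤ}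
    (h0 : ∀ k : ℤ, A (lp.single 2 (2 * k) (1 : ℂ)) = B (lp.single 2 (2 * k) (1 : ℂ)))
    (h1 : ∀ k : ℤ, A (lp.single 2 (2 * k + 1) (1 : ℂ)) = B (lp.single 2 (2 * k + 1) (1 : ℂ))) :
    A = B := by
  refine lp.ext_continuousLinearMap (by norm_num) fun i => ?_
  ext1
  rcases Int.even_or_odd' i with ⟨k, rfl | rfl⟩
  · exact h0 k
  · exact h1 k

lemma mul_ap (A B : ℓ²ℤ →L[ℂ] ℓ²ℤ) (f : ℓ²ℤ) : (A * B) f = A (B f) := rfl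
lemma one_ap (f : ℓ²ℤ) : (1 : ℓ²ℤ →L[ℂ] ℓ²ℤ) f = f := rfl

instance : Nontrivial ℓ²ℤ := ⟨⟨lp.single 2 0 (1 : ℂ), 0, fun h => by
  have := congrArg (fun g : ℓ²ℤ => g 0) h
  simp at this⟩⟩

lemma key_alg {A : Type*} [Ring A] [Algebra ℂ A] (X Y : A) (hXY : X * Y = 1) (z w a b c : ℂ)
    (hw0 : w ≠ 0) (h1 : c = a + b * (w + w⁻¹)) :
    z • (algebraMap ℂ A c - (algebraMap ℂ A a + b • (X + Y))) =
      (X - w • 1) * ((-(z * b)) • (1 - w⁻¹ • Y)) := by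
  have h2 : (X - w • 1) * (1 - w⁻¹ • Y) = X + Y - (w + w⁻¹) • (1 : A) := by
    rw [sub_mul, mul_sub, mul_sub, mul_smul_comm, hXY]
    simp only [smul_mul_assoc, one_mul, mul_one, smul_smul, mul_inv_cancel₀ hw0, one_smul]
    module
  rw [mul_smul_comm, h2, h1, Algebra.algebraMap_eq_smul_one, Algebra.algebraMap_eq_smul_one]
  module

/-- The shift by two. -/
noncomputable abbrev T : ℓ²ℤ →L[ℂ] ℓ²ℤ := (re (Equiv.subRight 2) : ℓ²ℤ →L[ℂ] ℓ²ℤ)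
/-- The inverse shift by two. -/
noncomputable abbrev T' : ℓ²ℤ →L[ℂ] ℓ²ℤ := ((re (Equiv.subRight 2)).symm : ℓ²ℤ →L[ℂ] ℓ²ℤ)
/-- The reflection. -/
noncomputable abbrev R : ℓ²ℤ →L[ℂ] ℓ²ℤ := (re (Equiv.neg ℤ) : ℓ²ℤ →L[ℂ] ℓ²ℤ)

lemma T_single (n : ℤ) : T (lp.single 2 n (1 : ℂ)) = lp.single 2 (n + 2) (1 : ℂ) :=
  re_single _ n
lemma T'_single (n : ℤ) : T' (lp.single 2 n (1 : ℂ)) = lp.single 2 (n - 2) (1 : ℂ) :=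
  re_symm_single _ n
lemma R_single (n : ℤ) : R (lp.single 2 n (1 : ℂ)) = lp.single 2 (-n) (1 : ℂ) :=
  re_single _ n
lemma T_apply (f : ℓ²ℤ) (n : ℤ) : T f n = f (n - 2) := rfl

lemma TT' : T * T' = 1 := by
  ext1 f; exact (re (Equiv.subRight 2)).apply_symm_apply f

lemma RR : R * R = 1 := by
  ext f n
  change f (- -n) = f n
  rw [neg_neg]

lemma coord_tendsto (f : ℓ²ℤ) (g : ℕ → ℤ) (hg : Function.Injective g) :
    Filter.Tendsto (fun k => ‖f (g k)‖) Filter.atTop (nhds 0) := by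
  have h := ((lp.memℓp f).summable (by norm_num)).tendsto_cofinite_zero
  have h1 := (h.comp hg.tendsto_cofinite)
  rw [Nat.cofinite_eq_atTop] at h1
  have h2 := h1.sqrt
  simpa [Function.comp_def] using h2

lemma T_sub_not_surj (w : ℂ) (hw : ‖w‖ = 1) (f : ℓ²ℤ)
    (hf : T f - w • f = lp.single 2 0 (1 : ℂ)) : False := by
  have hc : ∀ n : ℤ, f (n - 2) - w * f n = if n = 0 then 1 else 0 := by
    intro n
    have := congrArg (fun g : ℓ²ℤ => g n) hf
    simp only [lp.coeFn_sub, Pi.sub_apply, lp.coeFn_smul, Pi.smul_apply, smul_eq_mul, T_apply,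
      lp.single_apply, Pi.single_apply] at this
    exact this
  have hn : ∀ n : ℤ, n ≠ 0 → ‖f (n - 2)‖ = ‖f n‖ := by
    intro n h
    have := hc n
    rw [if_neg h, sub_eq_zero] at this
    rw [this, norm_mul, hw, one_mul]
  have hp : ∀ k : ℕ, ‖f (2 * (k : ℤ))‖ = ‖f 0‖ := by
    intro k
    induction k with
    | zero => simp
    | succ k ih =>
      rw [← ih, ← hn _ (by push_cast; omega)]
      congr 2; push_cast; ring_nf
  have hm : ∀ k : ℕ, ‖f (-2 - 2 * (k : ℤ))‖ = ‖f (-2)‖ := by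
    intro k
    induction k with
    | zero => simp
    | succ k ih =>
      rw [← ih, ← hn _ (by omega : -2 - 2 * (k : ℤ) ≠ 0)]
      congr 2; push_cast; ring_nf
  have e0 : ‖f 0‖ = 0 := by
    have := coord_tendsto f (fun k => 2 * (k : ℤ)) (fun a b h => by simpa using h)
    simp only [hp] at this
    exact tendsto_nhds_unique tendsto_const_nhds this
  have e2 : ‖f (-2)‖ = 0 := by
    have := coord_tendsto f (fun k => -2 - 2 * (k : ℤ)) (fun a b h => by simpa using h)
    simp only [hm] at this
    exact tendsto_nhds_unique tendsto_const_nhds this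
  have := hc 0
  rw [norm_eq_zero] at e0 e2
  simp [e0, e2] at this

lemma T_norm : ‖T‖ ≤ 1 := (re (Equiv.subRight 2)).toLinearIsometry.norm_toContinuousLinearMap_le
lemma T'_norm : ‖T'‖ ≤ 1 :=
  (re (Equiv.subRight 2)).symm.toLinearIsometry.norm_toContinuousLinearMap_le

lemma T_star : star T = T' := LinearIsometryEquiv.star_eq_symm _
lemma T'_star : star T' = T := by rw [← T_star, star_star]

/-- The spectrum of the reference operator is real and lies in an explicit interval. -/
lemma spec_A (a b : ℝ) (hb : 0 ≤ b) (μ : ℂ)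
    (hμ : μ ∈ spectrum ℂ (algebraMap ℂ (ℓ²ℤ →L[ℂ] ℓ²ℤ) a + (b : ℂ) • (T + T'))) :
    ∃ x : ℝ, μ = x ∧ |x - a| ≤ 2 * b := by
  have h1 : μ - a ∈ spectrum ℂ ((b : ℂ) • (T + T')) := by
    rw [← spectrum.add_mem_add_iff (s := (a : ℂ))]
    simpa [add_comm] using hμ
  have hs : IsSelfAdjoint ((b : ℂ) • (T + T')) := by
    rw [IsSelfAdjoint, star_smul, star_add, T_star, T'_star, add_comm]
    simp
  have h2 := hs.mem_spectrum_eq_re h1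
  have h3 := spectrum.norm_le_norm_of_mem h1
  have h4 : ‖(b : ℂ) • (T + T')‖ ≤ b * 2 := by
    rw [norm_smul]
    have := norm_add_le T T'
    have h5 := T_norm
    have h6 := T'_norm
    rw [Complex.norm_real, Real.norm_of_nonneg hb]
    gcongr; linarith
  refine ⟨μ.re, ?_, ?_⟩
  · rw [sub_eq_iff_eq_add] at h2
    rw [h2]; simp
  · rw [h2, Complex.norm_real] at h3
    rw [Complex.sub_re, Complex.ofReal_re, Real.norm_eq_abs] at h3
    linarith

lemma mem_arc (z : ℂ) (hz : z ≠ 0) (c s : ℝ) (h1 : s ≤ c) (h2 : c ≤ 1) (h3 : -1 ≤ s)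
    (h : z + z⁻¹ = ((2 * c : ℝ) : ℂ)) :
    ∃ ϑ : ℝ, |ϑ| ≤ Real.arccos s ∧ z = Complex.exp (ϑ * Complex.I) := by
  have hq : z * z - 2 * c * z + 1 = 0 := by
    field_simp at h
    push_cast at h
    linear_combination h
  have hcos : Real.cos (Real.arccos c) = c := Real.cos_arccos (by linarith) h2
  set u := Real.arccos c with hu
  have hu0 : 0 ≤ u := Real.arccos_nonneg c
  have hus : u ≤ Real.arccos s := Real.antitone_arccos h1
  have hcc : Complex.cos u = c := by rw [← Complex.ofReal_cos, hcos]
  have hf : (z - Complex.exp (u * I)) * (z - Complex.exp ((-u : ℝ) * I)) = 0 := by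
    push_cast
    rw [Complex.exp_mul_I, Complex.exp_mul_I, Complex.cos_neg, Complex.sin_neg, hcc]
    have hsc := Complex.sin_sq_add_cos_sq (u : ℂ)
    rw [hcc] at hsc
    linear_combination hq + hsc - (Complex.sin u)^2 * Complex.I_sq
  rcases mul_eq_zero.1 hf with h | h
  · exact ⟨u, by rwa [abs_of_nonneg hu0], sub_eq_zero.1 h⟩
  · exact ⟨-u, by rwa [abs_neg, abs_of_nonneg hu0], sub_eq_zero.1 h⟩

end UAM

open UAM

set_option maxHeartbeats 2000000 in
/-- The five-diagonal operator `S(t) = S_o S_e` of the one-dimensional unitary Anderson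
model, given as the product of two block-diagonal unitaries with `2×2` blocks
`[[r, t], [-t, r]]` shifted by one with respect to each other, has spectrum equal to the
arc `{e^{iϑ} : ϑ ∈ [-λ₀, λ₀]}` with `λ₀ = arccos(1 - 2t²)`. -/
theorem stmt9 (r t : ℝ) (hr : 0 ≤ r) (ht : 0 ≤ t) (hrt : r ^ 2 + t ^ 2 = 1)
    (So Se : ℓ²ℤ →L[ℂ] ℓ²ℤ)
    (hSo1 : ∀ k : ℤ, So (lp.single 2 (2 * k) (1 : ℂ)) =
      (r : ℂ) • lp.single 2 (2 * k) (1 : ℂ) - (t : ℂ) • lp.single 2 (2 * k + 1) (1 : ℂ))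
    (hSo2 : ∀ k : ℤ, So (lp.single 2 (2 * k + 1) (1 : ℂ)) =
      (t : ℂ) • lp.single 2 (2 * k) (1 : ℂ) + (r : ℂ) • lp.single 2 (2 * k + 1) (1 : ℂ))
    (hSe1 : ∀ k : ℤ, Se (lp.single 2 (2 * k + 1) (1 : ℂ)) =
      (r : ℂ) • lp.single 2 (2 * k + 1) (1 : ℂ) - (t : ℂ) • lp.single 2 (2 * k + 2) (1 : ℂ))
    (hSe2 : ∀ k : ℤ, Se (lp.single 2 (2 * k + 2) (1 : ℂ)) =
      (t : ℂ) • lp.single 2 (2 * k + 1) (1 : ℂ) + (r : ℂ) • lp.single 2 (2 * k + 2) (1 : ℂ)) :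
    spectrum ℂ (So ∘L Se) =
      {z : ℂ | ∃ ϑ : ℝ, |ϑ| ≤ Real.arccos (1 - 2 * t ^ 2) ∧
        z = Complex.exp (ϑ * Complex.I)} := by
  have E1 : ∀ k : ℤ, Se (lp.single 2 (2 * k) (1 : ℂ)) =
      (t : ℂ) • lp.single 2 (2 * k - 1) (1 : ℂ) + (r : ℂ) • lp.single 2 (2 * k) (1 : ℂ) := by
    intro k
    have := hSe2 (k - 1)
    rwa [show 2 * (k - 1) + 2 = 2 * k by ring, show 2 * (k - 1) + 1 = 2 * k - 1 by ring] at this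
  have hC : (r : ℂ) ^ 2 + (t : ℂ) ^ 2 = 1 := by exact_mod_cast hrt
  -- conjugates by the reflection
  have hQe0 : ∀ k : ℤ, (R * Se * R) (lp.single 2 (2 * k) (1 : ℂ)) =
      (r : ℂ) • lp.single 2 (2 * k) (1 : ℂ) + (t : ℂ) • lp.single 2 (2 * k + 1) (1 : ℂ) := by
    intro k
    simp only [mul_ap, R_single]
    rw [show -(2 * k) = 2 * (-k) by ring, E1]
    simp only [map_add, map_smul, R_single]
    rw [show -(2 * -k - 1) = 2 * k + 1 by ring, show -(2 * -k) = 2 * k by ring, add_comm]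
  have hQe1 : ∀ k : ℤ, (R * Se * R) (lp.single 2 (2 * k + 1) (1 : ℂ)) =
      (r : ℂ) • lp.single 2 (2 * k + 1) (1 : ℂ) - (t : ℂ) • lp.single 2 (2 * k) (1 : ℂ) := by
    intro k
    simp only [mul_ap, R_single]
    rw [show -(2 * k + 1) = 2 * (-k - 1) + 1 by ring, hSe1]
    simp only [map_sub, map_smul, R_single]
    rw [show -(2 * (-k - 1) + 1) = 2 * k + 1 by ring,
      show -(2 * (-k - 1) + 2) = 2 * k by ring]
  have hoe : So * (R * Se * R) = 1 := by
    apply ext_single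
    · intro k
      rw [mul_ap, hQe0]
      simp only [map_add, map_smul, hSo1, hSo2, one_ap]
      linear_combination (norm := module) hC • lp.single (E := fun _ : ℤ => ℂ) 2 (2 * k) (1 : ℂ)
    · intro k
      rw [mul_ap, hQe1]
      simp only [map_sub, map_smul, hSo1, hSo2, one_ap]
      linear_combination (norm := module) hC • lp.single (E := fun _ : ℤ => ℂ) 2 (2 * k + 1) (1 : ℂ)
  have heo : (R * Se * R) * So = 1 := by
    apply ext_single
    · intro k
      rw [mul_ap, hSo1]
      simp only [map_sub, map_smul, hQe0, hQe1, one_ap]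
      linear_combination (norm := module) hC • lp.single (E := fun _ : ℤ => ℂ) 2 (2 * k) (1 : ℂ)
    · intro k
      rw [mul_ap, hSo2]
      simp only [map_add, map_smul, hQe0, hQe1, one_ap]
      linear_combination (norm := module) hC • lp.single (E := fun _ : ℤ => ℂ) 2 (2 * k + 1) (1 : ℂ)
  have hRR := RR
  change spectrum ℂ (So * Se) = _
  set S := So * Se with hS
  set S' := R * S * R with hS'
  have hx : ∀ X : ℓ²ℤ →L[ℂ] ℓ²ℤ, R * (R * X) = X := fun X => by rw [← mul_assoc, hRR, one_mul]
  -- R So R is inverse to Se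
  have hoe' : (R * So * R) * Se = 1 := by
    have : R * (So * (R * Se * R)) * R = 1 := by rw [hoe, mul_one, hRR]
    simpa only [mul_assoc, hRR, mul_one] using this
  have heo' : Se * (R * So * R) = 1 := by
    have : R * ((R * Se * R) * So) * R = 1 := by rw [heo, mul_one, hRR]
    simpa only [mul_assoc, hx] using this
  have hS'2 : S' = (R * So * R) * (R * Se * R) := by
    simp only [hS', hS, mul_assoc, hx]
  have hSS' : S * S' = 1 := by
    rw [hS'2, hS, mul_assoc, ← mul_assoc Se, heo', one_mul, hoe]
  have hS'S : S' * S = 1 := by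
    rw [hS'2, hS, mul_assoc, ← mul_assoc _ So, heo, one_mul, hoe']
  have hSe0 : ∀ k : ℤ, S (lp.single 2 (2 * k) (1 : ℂ)) =
      (t : ℂ) • ((t : ℂ) • lp.single 2 (2 * k - 2) (1 : ℂ) +
        (r : ℂ) • lp.single 2 (2 * k - 1) (1 : ℂ)) +
      (r : ℂ) • ((r : ℂ) • lp.single 2 (2 * k) (1 : ℂ) -
        (t : ℂ) • lp.single 2 (2 * k + 1) (1 : ℂ)) := by
    intro k
    rw [hS, mul_ap, E1]
    have := hSo2 (k - 1)
    rw [show 2 * (k - 1) + 1 = 2 * k - 1 by ring, show 2 * (k - 1) = 2 * k - 2 by ring] at this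
    simp only [map_add, map_smul, hSo1, this]
  have hSod : ∀ k : ℤ, S (lp.single 2 (2 * k + 1) (1 : ℂ)) =
      (r : ℂ) • ((t : ℂ) • lp.single 2 (2 * k) (1 : ℂ) +
        (r : ℂ) • lp.single 2 (2 * k + 1) (1 : ℂ)) -
      (t : ℂ) • ((r : ℂ) • lp.single 2 (2 * k + 2) (1 : ℂ) -
        (t : ℂ) • lp.single 2 (2 * k + 3) (1 : ℂ)) := by
    intro k
    rw [hS, mul_ap, hSe1]
    have := hSo1 (k + 1)
    rw [show 2 * (k + 1) + 1 = 2 * k + 3 by ring, show 2 * (k + 1) = 2 * k + 2 by ring] at this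
    simp only [map_sub, map_smul, hSo2, this]
  have hA : S + S' = algebraMap ℂ (ℓ²ℤ →L[ℂ] ℓ²ℤ) ((2 * r ^ 2 : ℝ) : ℂ) +
      ((t ^ 2 : ℝ) : ℂ) • (T + T') := by
    apply ext_single
    · intro k
      have h1 := hSe0 (-k)
      simp only [_root_.add_apply, hS', mul_ap, hSe0,
        R_single, _root_.smul_apply, T_single, T'_single,
        Algebra.algebraMap_eq_smul_one, one_ap]
      rw [show -(2 * k) = 2 * (-k) by ring, h1]
      simp only [map_add, map_sub, map_smul, R_single]
      rw [show -(2 * -k) = 2 * k by ring, show -(2 * -k - 2) = 2 * k + 2 by ring,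
        show -(2 * -k - 1) = 2 * k + 1 by ring, show -(2 * -k + 1) = 2 * k - 1 by ring]
      push_cast
      module
    · intro k
      have h1 := hSod (-k - 1)
      simp only [_root_.add_apply, hS', mul_ap, hSod,
        R_single, _root_.smul_apply, T_single, T'_single,
        Algebra.algebraMap_eq_smul_one, one_ap]
      rw [show -(2 * k + 1) = 2 * (-k - 1) + 1 by ring, h1]
      simp only [map_add, map_sub, map_smul, R_single]
      rw [show -(2 * (-k - 1)) = 2 * k + 2 by ring, show -(2 * (-k - 1) + 1) = 2 * k + 1 by ring,
        show -(2 * (-k - 1) + 2) = 2 * k by ring, show -(2 * (-k - 1) + 3) = 2 * k - 1 by ring,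
        show 2 * k + 1 + 2 = 2 * k + 3 by ring, show 2 * k + 1 - 2 = 2 * k - 1 by ring]
      push_cast
      module
  -- factorization
  have hfac : ∀ z : ℂ, (algebraMap ℂ (ℓ²ℤ →L[ℂ] ℓ²ℤ) z - S) *
      (algebraMap ℂ (ℓ²ℤ →L[ℂ] ℓ²ℤ) z - S') =
      algebraMap ℂ (ℓ²ℤ →L[ℂ] ℓ²ℤ) (z * z + 1) - z • (S + S') := by
    intro z
    rw [sub_mul, mul_sub, mul_sub, hSS']
    simp only [Algebra.algebraMap_eq_smul_one, smul_mul_assoc, mul_smul_comm, one_mul, mul_one]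
    module
  have hfac' : ∀ z : ℂ, (algebraMap ℂ (ℓ²ℤ →L[ℂ] ℓ²ℤ) z - S') *
      (algebraMap ℂ (ℓ²ℤ →L[ℂ] ℓ²ℤ) z - S) =
      algebraMap ℂ (ℓ²ℤ →L[ℂ] ℓ²ℤ) (z * z + 1) - z • (S + S') := by
    intro z
    rw [sub_mul, mul_sub, mul_sub, hS'S]
    simp only [Algebra.algebraMap_eq_smul_one, smul_mul_assoc, mul_smul_comm, one_mul, mul_one]
    module
  have hscale : ∀ z : ℂ, z ≠ 0 → algebraMap ℂ (ℓ²ℤ →L[ℂ] ℓ²ℤ) (z * z + 1) - z • (S + S') =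
      z • (algebraMap ℂ (ℓ²ℤ →L[ℂ] ℓ²ℤ) (z + z⁻¹) - (S + S')) := by
    intro z hz
    rw [smul_sub, Algebra.algebraMap_eq_smul_one, Algebra.algebraMap_eq_smul_one, smul_smul,
      mul_add, mul_inv_cancel₀ hz]
  ext z
  simp only [Set.mem_ofPred_eq]
  constructor
  · intro hz
    have hz0 : z ≠ 0 := by
      rintro rfl
      exact (spectrum.zero_notMem_iff ℂ).2 ⟨⟨S, S', hSS', hS'S⟩, rfl⟩ hz
    have hm : z + z⁻¹ ∈ spectrum ℂ (S + S') := by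
      intro hu
      apply hz
      rw [spectrum.mem_resolventSet_iff] at hu ⊢
      have hu2 : IsUnit (algebraMap ℂ (ℓ²ℤ →L[ℂ] ℓ²ℤ) (z * z + 1) - z • (S + S')) := by
        rw [hscale z hz0]
        exact hu.smul (Units.mk0 z hz0)
      have hcomm : Commute (algebraMap ℂ (ℓ²ℤ →L[ℂ] ℓ²ℤ) z - S)
          (algebraMap ℂ (ℓ²ℤ →L[ℂ] ℓ²ℤ) z - S') := by
        rw [Commute, SemiconjBy, hfac, hfac']
      rw [← hfac, hcomm.isUnit_mul_iff] at hu2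
      exact hu2.1
    rw [hA] at hm
    obtain ⟨x, hx1, hx2⟩ := spec_A _ _ (by positivity) _ hm
    rw [abs_le] at hx2
    refine mem_arc z hz0 (x / 2) _ (by linarith) (by linarith) (by nlinarith) ?_
    rw [hx1]; congr 1; ring
  · rintro ⟨θ, hθ, rfl⟩ hu
    rw [spectrum.mem_resolventSet_iff] at hu
    set z := Complex.exp (θ * I) with hz
    have hz0 : z ≠ 0 := Complex.exp_ne_zero _
    have hzz : z + z⁻¹ = ((2 * Real.cos θ : ℝ) : ℂ) := by
      rw [hz, ← Complex.exp_neg]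
      push_cast
      rw [Complex.two_cos]
      ring_nf
    have hcos : 1 - 2 * t ^ 2 ≤ Real.cos θ := by
      rw [← Real.cos_abs]
      have h1 : 1 - 2 * t ^ 2 = Real.cos (Real.arccos (1 - 2 * t ^ 2)) :=
        (Real.cos_arccos (by nlinarith) (by nlinarith)).symm
      rw [h1]
      exact Real.cos_le_cos_of_nonneg_of_le_pi (abs_nonneg _) (Real.arccos_le_pi _) hθ
    have hcos1 := Real.cos_le_one θ
    obtain ⟨y, hy⟩ : ∃ y : ℝ, r ^ 2 + t ^ 2 * Real.cos y = Real.cos θ := by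
      rcases eq_or_ne t 0 with h0 | h0
      · subst h0
        refine ⟨0, ?_⟩
        nlinarith
      · have ht2 : 0 < t ^ 2 := by positivity
        refine ⟨Real.arccos ((Real.cos θ - r ^ 2) / t ^ 2), ?_⟩
        rw [Real.cos_arccos]
        · field_simp; ring
        · rw [le_div_iff₀ ht2]; linarith
        · rw [div_le_iff₀ ht2]; linarith
    have hu' : IsUnit (algebraMap ℂ (ℓ²ℤ →L[ℂ] ℓ²ℤ) z - S') := by
      have hR : IsUnit R := ⟨⟨R, R, hRR, hRR⟩, rfl⟩
      have : algebraMap ℂ (ℓ²ℤ →L[ℂ] ℓ²ℤ) z - S' =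
          R * (algebraMap ℂ (ℓ²ℤ →L[ℂ] ℓ²ℤ) z - S) * R := by
        rw [mul_sub, sub_mul, ← Algebra.commutes, mul_assoc, hRR, mul_one]
      rw [this]
      exact (hR.mul hu).mul hR
    have hun := hu.mul hu'
    rw [hfac, hscale z hz0, hzz, hA] at hun
    set w := Complex.exp (y * I) with hw
    have hw0 : w ≠ 0 := Complex.exp_ne_zero _
    have hww : w + w⁻¹ = ((2 * Real.cos y : ℝ) : ℂ) := by
      rw [hw, ← Complex.exp_neg]
      push_cast
      rw [Complex.two_cos]
      ring_nf
    have hTT := TT'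
    have key : z • (algebraMap ℂ (ℓ²ℤ →L[ℂ] ℓ²ℤ) ((2 * Real.cos θ : ℝ) : ℂ) -
        (algebraMap ℂ (ℓ²ℤ →L[ℂ] ℓ²ℤ) ((2 * r ^ 2 : ℝ) : ℂ) +
      ((t ^ 2 : ℝ) : ℂ) • (T + T'))) =
      (T - w • 1) * ((-(z * ((t ^ 2 : ℝ) : ℂ))) • (1 - w⁻¹ • T')) := by
      have h1 : ((2 * Real.cos θ : ℝ) : ℂ) = ((2 * r ^ 2 : ℝ) : ℂ) +
          ((t ^ 2 : ℝ) : ℂ) * (w + w⁻¹) := by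
        rw [hww, ← hy]; push_cast; ring
      exact key_alg T T' hTT z w _ _ _ hw0 h1
    rw [key] at hun
    obtain ⟨u, hu3⟩ := hun
    have h5 : (T - w • 1) * (((-(z * ((t ^ 2 : ℝ) : ℂ))) • (1 - w⁻¹ • T')) * (↑u⁻¹ :
        ℓ²ℤ →L[ℂ] ℓ²ℤ)) = 1 := by
      rw [← mul_assoc, ← hu3, Units.mul_inv]
    have h6 := congrArg (fun B : ℓ²ℤ →L[ℂ] ℓ²ℤ => B (lp.single 2 0 (1 : ℂ))) h5
    simp only [mul_ap (T - w • 1)] at h6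
    exact T_sub_not_surj w (Complex.norm_exp_ofReal_mul_I y) _ h6
end
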